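/- There exists a constant c > 0 depending only on d such that for every simplex set Φ ⊂ ℝ^d_0 and every ρ ∈ (0,1), ℝ^d_0 ∖ ((1−ρ)(n/2) S_Φ + Δ_Φ) ⊆ W'_Φ + B_{cρξ_Φ} + Δ_Φ, where B_s is the ball of radius s in ℝ^d_0. -/

import Mathlib

open scoped Pointwise

noncomputable section

abbrev SLR (d : ℕ) := Matrix.SpecialLinearGroup (Fin d) ℝ

instance (d : ℕ) : TopologicalSpace (SLR d) := instTopologicalSpaceSubtype

def Gamma (d : ℕ) : Subgroup (SLR d) :=
  (Matrix.SpecialLinearGroup.map (n := Fin d) (Int.castRingHom ℝ)).range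

abbrev XSpace (d : ℕ) := SLR d ⧸ Gamma d

def latticeOf (d : ℕ) (x : XSpace d) : Set (Fin d → ℝ) :=
  {w | ∃ g : SLR d, (QuotientGroup.mk g : XSpace d) = x ∧
      ∃ v : Fin d → ℤ, w = (g : Matrix (Fin d) (Fin d) ℝ).mulVec fun i => (v i : ℝ)}

def shortest (d : ℕ) (x : XSpace d) : ℝ :=
  sInf {r | ∃ w ∈ latticeOf d x, w ≠ 0 ∧ r = ‖w‖}

def aSL (d : ℕ) (t : Fin d → ℝ) (ht : ∑ i, t i = 0) : SLR d :=
  ⟨Matrix.diagonal fun i => Real.exp (t i), by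
    rw [Matrix.det_diagonal, ← Real.exp_sum, ht, Real.exp_zero]⟩

def Aorbit (d : ℕ) (x : XSpace d) : Set (XSpace d) :=
  {y | ∃ (t : Fin d → ℝ) (ht : ∑ i, t i = 0), y = aSL d t ht • x}

def stdLat (d : ℕ) : XSpace d := QuotientGroup.mk 1

/-- The hyperplane `ℝ^d_0` of zero coordinate sum, as a set. -/
def V0 (d : ℕ) : Set (Fin d → ℝ) := {t | ∑ i, t i = 0}

/-- The hyperplane `ℝ^d_0`, as a submodule. -/
def V0sub (d : ℕ) : Submodule ℝ (Fin d → ℝ) :=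
  LinearMap.ker (∑ i : Fin d, LinearMap.proj i)

/-- A simplex set: `d` vectors in `ℝ^d_0` summing to zero and spanning `ℝ^d_0`. -/
structure SimplexSet (d : ℕ) where
  elems : Finset (Fin d → ℝ)
  card_eq : elems.card = d
  sum_eq_zero : elems.sum id = 0
  span_eq : Submodule.span ℝ (elems : Set (Fin d → ℝ)) = V0sub d

/-- The lattice `Δ_Φ` associated to a simplex set. -/
def latticeOfSS {d : ℕ} (Φ : SimplexSet d) : AddSubgroup (Fin d → ℝ) :=
  AddSubgroup.closure (Φ.elems : Set (Fin d → ℝ))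

/-- `⌈t⌉ = max_i t_i`. -/
def ceilMax {d : ℕ} (t : Fin d → ℝ) : ℝ := ⨆ i, t i

/-- `ξ_Φ = max_{t ∈ Φ} ⌈t⌉`. -/
def xi {d : ℕ} (Φ : SimplexSet d) : ℝ :=
  sSup (ceilMax '' (Φ.elems : Set (Fin d → ℝ)))

/-- Square root of the absolute Gram determinant of a `(d-1)`-tuple of vectors. -/
def gram (d : ℕ) (v : Fin (d - 1) → (Fin d → ℝ)) : ℝ :=
  Real.sqrt |(Matrix.of fun i j : Fin (d - 1) => ∑ k, v i k * v j k).det|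

/-- The (euclidean) covolume of the lattice generated by a set `S ⊆ ℝ^d_0` of rank `d-1`:
the common value of the Gram determinant over all `(d-1)`-tuples generating the same
subgroup as `S`. -/
def covolSet (d : ℕ) (S : Set (Fin d → ℝ)) : ℝ :=
  sInf {r | ∃ v : Fin (d - 1) → (Fin d → ℝ),
      AddSubgroup.closure (Set.range v) = AddSubgroup.closure S ∧ r = gram d v}

/-- The covolume `|Δ_Φ|`. -/
def covolSS {d : ℕ} (Φ : SimplexSet d) : ℝ := covolSet d (Φ.elems : Set (Fin d → ℝ))

/-- The set `φ(stab_{UA}(x))` of logarithmic stabilizer times. -/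
def stabSet (d : ℕ) (x : XSpace d) : Set (Fin d → ℝ) :=
  {t | (∑ i, t i = 0) ∧ ∃ ε : Fin d → ℝ, (∀ i, ε i = 1 ∨ ε i = -1) ∧
      (fun v => (Matrix.diagonal fun i => ε i * Real.exp (t i)).mulVec v) '' latticeOf d x
        = latticeOf d x}

/-- The lattice `Δ_x = φ(stab_{UA}(x))`. -/
def DeltaX (d : ℕ) (x : XSpace d) : AddSubgroup (Fin d → ℝ) :=
  AddSubgroup.closure (stabSet d x)

/-- The covolume `|Δ_x|`. -/
def covolX (d : ℕ) (x : XSpace d) : ℝ := covolSet d (stabSet d x)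

/-- `Φ` is an `M`-tight simplex set for `x`. -/
def IsTight (d : ℕ) (M : ℝ) (x : XSpace d) (Φ : SimplexSet d) : Prop :=
  (Φ.elems : Set (Fin d → ℝ)) ⊆ (DeltaX d x : Set (Fin d → ℝ)) ∧
  shortest d x ≤ M * Real.exp (-((d - 1 : ℝ) / 2) * xi Φ)

/-- `Ω_M`: points of `Ω` admitting an `M`-tight simplex set. -/
def OmegaM (d : ℕ) (M : ℝ) : Set (XSpace d) :=
  {x | IsCompact (Aorbit d x) ∧ ∃ Φ : SimplexSet d, IsTight d M x Φ}

/-- The standard simplex set vectors `b_j` (with `-(d-1)` in coordinate `j`, `1` elsewhere). -/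
def bstar (d : ℕ) (j : Fin d) : Fin d → ℝ := fun i => if i = j then -(d - 1 : ℝ) else 1

/-- The points `w_τ^{Φ_*} = τ(d⁻¹ ∑_ℓ (ℓ-1) b_ℓ)`. -/
def wStar (d : ℕ) (τ : Equiv.Perm (Fin d)) : Fin d → ℝ :=
  fun i => (d : ℝ)⁻¹ * ∑ ℓ : Fin d, (ℓ : ℝ) * bstar d ℓ (τ.symm i)

/-- `h` is a distortion map for `Φ`: a linear map with `h Φ_* = |Δ_Φ|^{-1/(d-1)} Φ`. -/
def IsDistortion {d : ℕ} (Φ : SimplexSet d) (h : (Fin d → ℝ) →ₗ[ℝ] (Fin d → ℝ)) : Prop :=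
  h '' Set.range (bstar d) =
    (fun v => (covolSS Φ) ^ (-(1 : ℝ) / (d - 1 : ℝ)) • v) '' (Φ.elems : Set (Fin d → ℝ))

/-- `w_τ^Φ = |Δ_Φ|^{1/(d-1)} h_Φ (w_τ^{Φ_*})`. -/
def wPhi {d : ℕ} (Φ : SimplexSet d) (h : (Fin d → ℝ) →ₗ[ℝ] (Fin d → ℝ))
    (τ : Equiv.Perm (Fin d)) : Fin d → ℝ :=
  (covolSS Φ) ^ ((1 : ℝ) / (d - 1 : ℝ)) • h (wStar d τ)

/-- `S'` is a set of representatives for the cosets `𝒮 / ⟨θ⟩`, `θ` the cyclic rotation. -/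
def IsRepSet (d : ℕ) (S' : Set (Equiv.Perm (Fin d))) : Prop :=
  ∀ τ : Equiv.Perm (Fin d), ∃! σ, σ ∈ S' ∧ τ⁻¹ * σ ∈ Subgroup.zpowers (finRotate d)

/-- The closed ball of radius `r` in `ℝ^d_0`. -/
def ballV0 (d : ℕ) (r : ℝ) : Set (Fin d → ℝ) := {t | (∑ i, t i = 0) ∧ ‖t‖ ≤ r}

/-- Operator norm of a matrix with respect to the supremum norm. -/
def opNorm (d : ℕ) (g : Matrix (Fin d) (Fin d) ℝ) : ℝ :=
  sSup {r | ∃ v : Fin d → ℝ, ‖v‖ ≤ 1 ∧ r = ‖g.mulVec v‖}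

/-- Operator norm of a linear map restricted to the hyperplane `ℝ^d_0`. -/
def normOnV0 (d : ℕ) (h : (Fin d → ℝ) →ₗ[ℝ] (Fin d → ℝ)) : ℝ :=
  sSup {r | ∃ v : Fin d → ℝ, (∑ i, v i = 0) ∧ ‖v‖ ≤ 1 ∧ r = ‖h v‖}

/-- `Ω_M(ε, C)`. -/
def OmegaMEC (d : ℕ) (M ε C : ℝ) : Set (XSpace d) :=
  {x | IsCompact (Aorbit d x) ∧ ∃ Φ : SimplexSet d, IsTight d M x Φ ∧
    ∃ h, IsDistortion Φ h ∧
      ∀ τ : Equiv.Perm (Fin d), ∃ (hw : ∑ i, wPhi Φ h τ i = 0)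
        (g : SLR d) (s : Fin d → ℝ) (hs : ∑ i, s i = 0),
        opNorm d ((g : Matrix (Fin d) (Fin d) ℝ) - 1) ≤ C * Real.exp (-(covolX d x) ^ ε) ∧
        aSL d (wPhi Φ h τ) hw • x = (g * aSL d s hs) • stdLat d}

/-- Homothety–`GL(ℤ)` equivalence of `(d-1)`-tuples: same lattice shape. -/
def shapeRel (d : ℕ) (v w : Fin (d - 1) → (Fin d → ℝ)) : Prop :=
  ∃ c : ℝ, 0 < c ∧ ∃ g : Matrix (Fin (d - 1)) (Fin (d - 1)) ℤ, IsUnit g.det ∧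
    ∀ i, w i = c • ∑ j, ((g i j : ℝ) • v j)

/-- The space of shapes of lattices in `ℝ^d_0` (with the quotient topology). -/
def ShapeSpace (d : ℕ) := Quot (shapeRel d)

instance (d : ℕ) : TopologicalSpace (ShapeSpace d) :=
  instTopologicalSpaceQuot

/-- The shape of the lattice generated by a tuple. -/
def shapeOf (d : ℕ) (v : Fin (d - 1) → (Fin d → ℝ)) : ShapeSpace d := Quot.mk _ v

/-- An enumeration of the elements of a simplex set. -/
def ssEnum {d : ℕ} (Φ : SimplexSet d) : Fin d → (Fin d → ℝ) :=
  fun i => ((Φ.elems.equivFin.symm (finCongr Φ.card_eq.symm i)) : Fin d → ℝ)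

/-- The shape of `Δ_Φ` (generated by the first `d-1` elements of `Φ`). -/
def shapeOfSS {d : ℕ} (Φ : SimplexSet d) : ShapeSpace d :=
  shapeOf d fun i : Fin (d - 1) => ssEnum Φ (Fin.castLE (Nat.sub_le d 1) i)

/-- `Ω_{M,K}`. -/
def OmegaMK (d : ℕ) (M : ℝ) (K : Set (ShapeSpace d)) : Set (XSpace d) :=
  {x | IsCompact (Aorbit d x) ∧ ∃ Φ : SimplexSet d, IsTight d M x Φ ∧ shapeOfSS Φ ∈ K}

theorem gram_eq (d : ℕ) (v : Fin (d - 1) → (Fin d → ℝ)) :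
    gram d v = Real.sqrt |(Matrix.of v * (Matrix.of v).transpose).det| := by
  rfl

theorem gram_pos {d : ℕ} {v : Fin (d - 1) → (Fin d → ℝ)} (hv : LinearIndependent ℝ v) :
    0 < gram d v := by
  rw [gram_eq, Real.sqrt_pos, abs_pos]
  have := Matrix.PosDef.mul_conjTranspose_self (Matrix.of v)
    (Matrix.vecMul_injective_iff.2 hv)
  simpa [Matrix.conjTranspose_eq_transpose_of_trivial] using this.det_pos.ne'

/-- If `w` is an integral combination of `v`, its Gram matrix is a congruence transform. -/
theorem exists_int_det_gram {d : ℕ} {v w : Fin (d - 1) → (Fin d → ℝ)}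
    (h : ∀ i, w i ∈ AddSubgroup.closure (Set.range v)) :
    ∃ k : ℤ, (Matrix.of w * (Matrix.of w).transpose).det =
      (k : ℝ) ^ 2 * (Matrix.of v * (Matrix.of v).transpose).det := by
  choose a ha using fun i => AddSubgroup.exists_of_mem_closure_range _ _ (h i)
  have hw : Matrix.of w = (Matrix.of a).map (Int.cast : ℤ → ℝ) * Matrix.of v := by
    ext i j
    simp [ha, Matrix.mul_apply]
  refine ⟨(Matrix.of a).det, ?_⟩
  have hdet : ((Matrix.of a).map (Int.cast : ℤ → ℝ)).det = ((Matrix.of a).det : ℝ) :=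
    ((Int.castRingHom ℝ).map_det (Matrix.of a)).symm
  rw [hw, Matrix.transpose_mul, Matrix.mul_assoc, ← Matrix.mul_assoc (Matrix.of v),
    Matrix.det_mul, Matrix.det_mul, Matrix.det_transpose, hdet]
  ring

theorem gram_le_of_closure_eq {d : ℕ} {v w : Fin (d - 1) → (Fin d → ℝ)}
    (hw : LinearIndependent ℝ w)
    (h : AddSubgroup.closure (Set.range v) = AddSubgroup.closure (Set.range w)) :
    gram d w ≤ gram d v := by
  obtain ⟨k, hk⟩ := exists_int_det_gram (v := v) (w := w) fun i =>
    h ▸ AddSubgroup.subset_closure (Set.mem_range_self i)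
  obtain ⟨l, hl⟩ := exists_int_det_gram (v := w) (w := v) fun i =>
    h ▸ AddSubgroup.subset_closure (Set.mem_range_self i)
  have hpos := gram_pos hw
  rw [gram_eq, Real.sqrt_pos, abs_pos] at hpos
  have hl0 : l ≠ 0 := by
    rintro rfl
    rw [hk, hl] at hpos
    simp at hpos
  have hl1 : (1 : ℝ) ≤ (l : ℝ) ^ 2 := by
    exact_mod_cast Int.one_le_abs hl0 |>.trans (by nlinarith [sq_abs l, Int.one_le_abs hl0])
  rw [gram_eq, gram_eq, hl, abs_mul, abs_of_nonneg (sq_nonneg (l : ℝ))]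
  exact Real.sqrt_le_sqrt (le_mul_of_one_le_left (abs_nonneg _) hl1)

theorem finrank_V0sub (m : ℕ) : Module.finrank ℝ (V0sub (m + 1)) = m := by
  have hne : (∑ i : Fin (m + 1), LinearMap.proj i : (Fin (m + 1) → ℝ) →ₗ[ℝ] ℝ) ≠ 0 := by
    intro h
    simpa [Finset.sum_apply, Pi.single_apply] using LinearMap.congr_fun h (Pi.single 0 1)
  have := Module.Dual.finrank_ker_add_one_of_ne_zero hne
  rw [Module.finrank_fin_fun] at this
  exact Nat.add_right_cancel this

theorem mem_V0sub {d : ℕ} {t : Fin d → ℝ} : t ∈ V0sub d ↔ ∑ i, t i = 0 := by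
  simp [V0sub]

theorem covolSet_range_pos {m : ℕ} {φ : Fin (m + 1) → (Fin (m + 1) → ℝ)}
    (hsum : ∑ j, φ j = 0) (hspan : Submodule.span ℝ (Set.range φ) = V0sub (m + 1)) :
    0 < covolSet (m + 1) (Set.range φ) := by
  let v : Fin (m + 1 - 1) → (Fin (m + 1) → ℝ) := fun i => φ (Fin.castSucc i)
  have hlast : φ (Fin.last m) = -∑ i, v i := by
    rw [Fin.sum_univ_castSucc] at hsum
    exact eq_neg_of_add_eq_zero_right hsum
  have hclosure : AddSubgroup.closure (Set.range v) = AddSubgroup.closure (Set.range φ) := by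
    refine le_antisymm (AddSubgroup.closure_mono ?_) ((AddSubgroup.closure_le _).2 ?_)
    · rintro _ ⟨i, rfl⟩
      exact ⟨_, rfl⟩
    · rintro _ ⟨i, rfl⟩
      induction i using Fin.lastCases with
      | last =>
        rw [hlast]
        exact neg_mem (sum_mem fun i _ => AddSubgroup.subset_closure ⟨i, rfl⟩)
      | cast i => exact AddSubgroup.subset_closure ⟨i, rfl⟩
  have hspanv : Submodule.span ℝ (Set.range v) = V0sub (m + 1) := by
    rw [← hspan]
    refine le_antisymm (Submodule.span_mono ?_) (Submodule.span_le.2 ?_)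
    · rintro _ ⟨i, rfl⟩
      exact ⟨_, rfl⟩
    · rintro _ ⟨i, rfl⟩
      induction i using Fin.lastCases with
      | last =>
        rw [hlast]
        exact neg_mem (sum_mem fun i _ => Submodule.subset_span ⟨i, rfl⟩)
      | cast i => exact Submodule.subset_span ⟨i, rfl⟩
  have hli : LinearIndependent ℝ v := by
    rw [linearIndependent_iff_card_eq_finrank_span, Set.finrank, hspanv, finrank_V0sub]
    simp
  refine (gram_pos hli).trans_le (le_csInf ⟨_, v, hclosure, rfl⟩ ?_)
  rintro _ ⟨u, hu, rfl⟩
  exact gram_le_of_closure_eq hli (hu.trans hclosure.symm)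

theorem covolSS_pos {m : ℕ} (Φ : SimplexSet (m + 1)) : 0 < covolSS Φ := by
  let e : Fin (m + 1) ≃ Φ.elems := (Φ.elems.equivFinOfCardEq Φ.card_eq).symm
  have hrange : Set.range (fun i => (e i : Fin (m + 1) → ℝ)) = Φ.elems := by
    ext t
    exact ⟨fun ⟨i, hi⟩ => hi ▸ (e i).2, fun ht => ⟨e.symm ⟨t, ht⟩, by simp⟩⟩
  rw [covolSS, ← hrange]
  refine covolSet_range_pos ?_ (hrange ▸ Φ.span_eq)
  rw [e.sum_comp (fun t : Φ.elems => (t : Fin (m + 1) → ℝ)),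
    Finset.sum_coe_sort Φ.elems (fun t => t)]
  exact Φ.sum_eq_zero

/-- The point with barycentric-type coordinates `ℓ / (m + 1)` in the order given by `τ`. -/
def orderedPoint {m : ℕ} {E : Type*} [AddCommGroup E] [Module ℝ E] (φ : Fin (m + 1) → E)
    (τ : Equiv.Perm (Fin (m + 1))) : E :=
  ((m : ℝ) + 1)⁻¹ • ∑ ℓ : Fin (m + 1), (ℓ : ℝ) • φ (τ ℓ)

section OrderedPoint

variable {m : ℕ} {E : Type*} [AddCommGroup E] [Module ℝ E] {φ : Fin (m + 1) → E}

theorem orderedPoint_mul_finRotate (hsum : ∑ j, φ j = 0) (τ : Equiv.Perm (Fin (m + 1))) :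
    orderedPoint φ (τ * finRotate (m + 1)) = orderedPoint φ τ + φ (τ 0) := by
  have hm : (m : ℝ) + 1 ≠ 0 := by positivity
  have hcoe (ℓ : Fin (m + 1)) : ((finRotate (m + 1) ℓ : Fin (m + 1)) : ℝ) =
      ℓ + 1 - if ℓ = Fin.last m then (m : ℝ) + 1 else 0 := by
    rw [coe_finRotate]
    split_ifs with h <;> simp [h]
  have hτ : ∑ ℓ, φ (τ (finRotate (m + 1) ℓ)) = 0 := by
    rw [Equiv.sum_comp (finRotate (m + 1)) fun ℓ => φ (τ ℓ), Equiv.sum_comp τ φ, hsum]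
  have key : ∑ ℓ : Fin (m + 1), (ℓ : ℝ) • φ (τ ℓ) =
      ∑ ℓ : Fin (m + 1), (ℓ : ℝ) • φ (τ (finRotate (m + 1) ℓ)) - ((m : ℝ) + 1) • φ (τ 0) := by
    rw [← Equiv.sum_comp (finRotate (m + 1)) fun ℓ : Fin (m + 1) => (ℓ : ℝ) • φ (τ ℓ)]
    simp only [hcoe, sub_smul, add_smul, one_smul, ite_smul, zero_smul, Finset.sum_sub_distrib,
      Finset.sum_add_distrib, hτ, Finset.sum_ite_eq', Finset.mem_univ, if_true, finRotate_last,
      add_zero]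
  simp only [orderedPoint, key, Equiv.Perm.mul_apply, smul_sub, smul_smul, inv_mul_cancel₀ hm,
    one_smul, sub_add_cancel]

theorem orderedPoint_sub_mem_of_zpowers (hsum : ∑ j, φ j = 0) {σ τ : Equiv.Perm (Fin (m + 1))}
    (h : τ⁻¹ * σ ∈ Subgroup.zpowers (finRotate (m + 1))) :
    orderedPoint φ σ - orderedPoint φ τ ∈ AddSubgroup.closure (Set.range φ) := by
  obtain ⟨k, hk⟩ := h
  obtain rfl : σ = τ * finRotate (m + 1) ^ k := inv_mul_eq_iff_eq_mul.1 hk.symm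
  clear hk
  have hstep (π : Equiv.Perm (Fin (m + 1))) : φ (π 0) ∈ AddSubgroup.closure (Set.range φ) :=
    AddSubgroup.subset_closure ⟨_, rfl⟩
  induction k using Int.induction_on with
  | zero => simp
  | succ k ih =>
    rw [zpow_add_one, ← mul_assoc, orderedPoint_mul_finRotate hsum, add_sub_right_comm]
    exact add_mem ih (hstep _)
  | pred k ih =>
    have := orderedPoint_mul_finRotate hsum (τ * finRotate (m + 1) ^ (-(k : ℤ) - 1))
    rw [mul_assoc, ← zpow_add_one, sub_add_cancel] at this
    rw [← sub_eq_iff_eq_add] at this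
    rw [← this, sub_right_comm]
    exact sub_mem ih (hstep _)

theorem sum_smul_mem_smul_convexHull {ι : Type*} [Fintype ι] {z : ι → E} {y : ι → ℝ} {r : ℝ}
    (hr : 0 < r) (hy : ∀ i, 0 ≤ y i) (hysum : ∑ i, y i = r) :
    ∑ i, y i • z i ∈ r • convexHull ℝ (Set.range z) := by
  refine ⟨∑ i, (r⁻¹ * y i) • z i, (convex_convexHull ℝ _).sum_mem (fun i _ => ?_) ?_
    fun i _ => subset_convexHull ℝ _ ⟨i, rfl⟩, ?_⟩
  · exact mul_nonneg (inv_nonneg.2 hr.le) (hy i)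
  · rw [← Finset.mul_sum, hysum, inv_mul_cancel₀ hr.ne']
  · simp [Finset.smul_sum, smul_smul, mul_inv_cancel_left₀ hr.ne']

/-- If `f` is monotone with values in `[0, 1)` and `∑ f j • φ j` avoids the lattice translates
of the dilated simplex, every sum of cyclic differences exceeds the dilation factor. -/
theorem lt_of_notMem_smul_convexHull_add (hsum : ∑ j, φ j = 0) {f : Fin (m + 1) → ℝ}
    (hf0 : ∀ j, 0 ≤ f j) (hf1 : ∀ j, f j < 1) (hmono : Monotone f) {r : ℝ} (hr : 0 < r)
    (hx : ∑ j, f j • φ j ∉ r • convexHull ℝ (Set.range φ) +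
      (AddSubgroup.closure (Set.range φ) : Set E)) (k : Fin (m + 1)) :
    r < ∑ j, f j - (m + 1) * f k + k := by
  by_contra! hle
  set G : ℝ := ∑ j, f j - (m + 1) * f k + k with hG
  have hm : (m : ℝ) + 1 ≠ 0 := by positivity
  let t : ℝ := (r - G) / (m + 1)
  have ht : 0 ≤ t := div_nonneg (sub_nonneg.2 hle) (by positivity)
  let y : Fin (m + 1) → ℝ := fun j => f j - f k + (if j < k then 1 else 0) + t
  have hy (j) : 0 ≤ y j := by
    by_cases hjk : j < k
    · simp only [y, hjk, if_true]
      linarith [hf0 j, hf1 k]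
    · simp only [y, hjk, if_false]
      linarith [hmono (not_lt.1 hjk)]
  have hcard : (∑ j : Fin (m + 1), if j < k then (1 : ℝ) else 0) = k := by
    rw [Finset.sum_boole, ← Fin.card_Iio k]
    congr 2
    ext j
    simp
  have hysum : ∑ j, y j = r := by
    simp only [y, Finset.sum_add_distrib, Finset.sum_sub_distrib, hcard, Finset.sum_const,
      Finset.card_univ, Fintype.card_fin, nsmul_eq_mul, t]
    push_cast
    rw [mul_div_cancel₀ _ hm, hG]
    ring
  refine hx ⟨_, sum_smul_mem_smul_convexHull hr hy hysum,
    -∑ j, if j < k then φ j else 0, neg_mem (sum_mem fun j _ => ?_), ?_⟩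
  · split_ifs
    · exact AddSubgroup.subset_closure ⟨j, rfl⟩
    · exact zero_mem _
  · simp only [y, add_smul, sub_smul, Finset.sum_add_distrib, Finset.sum_sub_distrib,
      ← Finset.smul_sum, hsum, smul_zero, ite_smul, one_smul, zero_smul]
    abel

end OrderedPoint

/-- Reals with prescribed average that are all bounded below by slightly less than the average
are all close to the average. -/
theorem abs_sub_le_of_sum_eq {ι : Type*} [Fintype ι] {G : ι → ℝ} {a δ : ℝ}
    (hG : ∀ k, a - δ ≤ G k) (hsum : ∑ k, G k = Fintype.card ι * a) (k : ι) :
    |G k - a| ≤ Fintype.card ι * δ := by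
  have hcard : (1 : ℝ) ≤ Fintype.card ι := by
    exact_mod_cast Fintype.card_pos_iff.2 ⟨k⟩
  have h := Finset.single_le_sum (f := fun j => G j - a + δ)
    (fun j _ => by linarith [hG j]) (Finset.mem_univ k)
  simp only [Finset.sum_add_distrib, Finset.sum_sub_distrib, hsum, Finset.sum_const,
    Finset.card_univ, nsmul_eq_mul] at h
  have hδ : 0 ≤ Fintype.card ι * δ := by
    have := Finset.sum_nonneg fun j (_ : j ∈ Finset.univ) => sub_nonneg.2 (hG j)
    simp only [Finset.sum_sub_distrib, hsum, Finset.sum_const, Finset.card_univ,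
      nsmul_eq_mul] at this
    linarith
  have hδ' : 0 ≤ δ := nonneg_of_mul_nonneg_right hδ (by linarith)
  rw [abs_le]
  constructor
  · nlinarith [hG k]
  · linarith

theorem norm_le_mul_ceilMax {m : ℕ} {t : Fin (m + 1) → ℝ} (ht : ∑ i, t i = 0) :
    ‖t‖ ≤ (m + 1) * ceilMax t := by
  have hle (i) : t i ≤ ceilMax t := le_ciSup (Set.finite_range t).bddAbove i
  have h0 : 0 ≤ ceilMax t := by
    have := Finset.sum_le_sum fun i (_ : i ∈ Finset.univ) => hle i
    rw [ht, Finset.sum_const, Finset.card_univ, Fintype.card_fin, nsmul_eq_mul] at this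
    exact nonneg_of_mul_nonneg_right this (by positivity)
  refine (pi_norm_le_iff_of_nonneg (by positivity)).2 fun i => abs_le.2 ⟨?_, ?_⟩
  · have h := Finset.single_le_sum (f := fun j => ceilMax t - t j)
      (fun j _ => sub_nonneg.2 (hle j)) (Finset.mem_univ i)
    simp only [Finset.sum_sub_distrib, ht, Finset.sum_const, Finset.card_univ, Fintype.card_fin,
      nsmul_eq_mul] at h
    push_cast at h
    linarith
  · nlinarith [hle i, mul_nonneg (Nat.cast_nonneg (α := ℝ) m) h0]

theorem ceilMax_le_xi {d : ℕ} (Φ : SimplexSet d) {t : Fin d → ℝ} (ht : t ∈ Φ.elems) :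
    ceilMax t ≤ xi Φ :=
  le_csSup (Φ.elems.finite_toSet.image _).bddAbove ⟨t, ht, rfl⟩

theorem SimplexSet.sum_apply_eq_zero {d : ℕ} (Φ : SimplexSet d) {t : Fin d → ℝ}
    (ht : t ∈ Φ.elems) : ∑ i, t i = 0 :=
  mem_V0sub.1 (Φ.span_eq ▸ Submodule.subset_span ht)

/-- A distortion map enumerates the simplex set in such a way that the points `w_τ^Φ` become
the ordered points of the enumeration. -/
theorem IsDistortion.exists_enum {m : ℕ} {Φ : SimplexSet (m + 1)}
    {h : (Fin (m + 1) → ℝ) →ₗ[ℝ] (Fin (m + 1) → ℝ)} (hh : IsDistortion Φ h) :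
    ∃ φ : Fin (m + 1) → (Fin (m + 1) → ℝ), Set.range φ = Φ.elems ∧ ∑ j, φ j = 0 ∧
      wPhi Φ h = orderedPoint φ := by
  have hV := covolSS_pos Φ
  let φ : Fin (m + 1) → (Fin (m + 1) → ℝ) := fun j =>
    (covolSS Φ) ^ ((1 : ℝ) / (((m + 1 : ℕ) : ℝ) - 1)) • h (bstar (m + 1) j)
  have hrange : Set.range φ = Φ.elems := by
    have : Set.range φ = (fun v => (covolSS Φ) ^ ((1 : ℝ) / (((m + 1 : ℕ) : ℝ) - 1)) • v) ''
        (h '' Set.range (bstar (m + 1))) := by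
      rw [← Set.range_comp, ← Set.range_comp]
      rfl
    rw [this, hh, Set.image_image]
    simp only [smul_smul, ← Real.rpow_add hV, neg_div, add_neg_cancel, Real.rpow_zero, one_smul,
      Set.image_id']
  have himage : Finset.univ.image φ = Φ.elems := by
    apply Finset.coe_injective
    simpa using hrange
  have hinj : Function.Injective φ := by
    rw [← Set.injOn_univ, ← Finset.coe_univ, ← Finset.card_image_iff, himage, Φ.card_eq]
    simp
  refine ⟨φ, hrange, ?_, ?_⟩
  · rw [← Φ.sum_eq_zero, ← himage, Finset.sum_image hinj.injOn]
    rfl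
  · funext τ
    have hw : wStar (m + 1) τ = ((m : ℝ) + 1)⁻¹ •
        ∑ ℓ : Fin (m + 1), (ℓ : ℝ) • bstar (m + 1) (τ ℓ) := by
      funext i
      simp [wStar, bstar, Equiv.symm_apply_eq]
    simp only [wPhi, orderedPoint, hw, φ, map_smul, map_sum, Finset.smul_sum, smul_smul]
    refine Finset.sum_congr rfl fun ℓ _ => ?_
    congr 1
    ring

theorem stmt12 (d : ℕ) (hd : 2 ≤ d) :
    ∃ c : ℝ, 0 < c ∧
      ∀ (Φ : SimplexSet d) (h : (Fin d → ℝ) →ₗ[ℝ] (Fin d → ℝ)), IsDistortion Φ h →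
        ∀ S' : Set (Equiv.Perm (Fin d)), IsRepSet d S' →
          ∀ ρ : ℝ, 0 < ρ → ρ < 1 →
            V0 d \ (((1 - ρ) * ((d - 1 : ℝ) / 2)) • convexHull ℝ (Φ.elems : Set (Fin d → ℝ)) +
                (latticeOfSS Φ : Set (Fin d → ℝ))) ⊆
              wPhi Φ h '' S' + ballV0 d (c * ρ * xi Φ) +
                (latticeOfSS Φ : Set (Fin d → ℝ)) := by
  obtain ⟨m, rfl⟩ : ∃ m, d = m + 1 := ⟨d - 1, by omega⟩
  have hm : (1 : ℝ) ≤ m := by exact_mod_cast (by omega : 1 ≤ m)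
  refine ⟨(m + 1) ^ 3, by positivity, ?_⟩
  rintro Φ h hh S' hS' ρ hρ0 hρ1 x ⟨hx0, hx⟩
  obtain ⟨φ, hrange, hsum, hwPhi⟩ := hh.exists_enum
  have hφ (j) : φ j ∈ Φ.elems := by
    rw [← Finset.mem_coe, ← hrange]
    exact Set.mem_range_self j
  rw [latticeOfSS, ← hrange] at hx ⊢
  rw [hwPhi]
  set Δ := AddSubgroup.closure (Set.range φ)
  have hcast : ((m + 1 : ℕ) : ℝ) - 1 = m := by push_cast; ring
  rw [hcast] at hx
  obtain ⟨a, rfl⟩ : ∃ a : Fin (m + 1) → ℝ, ∑ j, a j • φ j = x := by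
    rw [← Submodule.mem_span_range_iff_exists_fun, hrange, Φ.span_eq]
    exact mem_V0sub.2 hx0
  let σ := Tuple.sort fun j => Int.fract (a j)
  let f : Fin (m + 1) → ℝ := fun j => Int.fract (a (σ j))
  let G : Fin (m + 1) → ℝ := fun k => ∑ j, f j - (m + 1) * f k + k
  let y : Fin (m + 1) → ℝ := fun k => -((m : ℝ) + 1)⁻¹ * (G k - m / 2)
  have hsumσ : ∑ j, φ (σ j) = 0 := by rw [Equiv.sum_comp σ φ, hsum]
  have hfloor : ∑ j, (⌊a j⌋ : ℝ) • φ j ∈ Δ := by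
    refine sum_mem fun j _ => ?_
    rw [Int.cast_smul_eq_zsmul]
    exact zsmul_mem (AddSubgroup.subset_closure (Set.mem_range_self j)) _
  have hfract : ∑ j, a j • φ j = ∑ j, f j • φ (σ j) + ∑ j, (⌊a j⌋ : ℝ) • φ j := by
    rw [Equiv.sum_comp σ fun j => Int.fract (a j) • φ j, ← Finset.sum_add_distrib]
    simp only [← add_smul, Int.fract_add_floor]
  have hrangeσ : Set.range (φ ∘ σ) = Set.range φ := σ.surjective.range_comp φ
  have hr : 0 < (1 - ρ) * ((m : ℝ) / 2) := by
    have : 0 < 1 - ρ := by linarith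
    positivity
  have hlt (k) : (1 - ρ) * ((m : ℝ) / 2) < G k := by
    refine lt_of_notMem_smul_convexHull_add (φ := φ ∘ σ) hsumσ (fun j => Int.fract_nonneg _)
      (fun j => Int.fract_lt_one _) (Tuple.monotone_sort fun j => Int.fract (a j)) hr ?_ k
    rw [hrangeσ]
    rintro ⟨s, hs, l, hl, hsl⟩
    refine hx ⟨s, hs, l + ∑ j, (⌊a j⌋ : ℝ) • φ j, add_mem hl hfloor, ?_⟩
    rw [hfract]
    change s + l = ∑ j, f j • φ (σ j) at hsl
    change s + (l + _) = _
    rw [← add_assoc, hsl]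
  have hGsum : ∑ k, G k = Fintype.card (Fin (m + 1)) * ((m : ℝ) / 2) := by
    have hid : ∑ k : Fin (m + 1), (k : ℝ) = (m + 1) * m / 2 := by
      rw [Fin.sum_univ_eq_sum_range fun k => (k : ℝ)]
      have := Finset.sum_range_id_mul_two (m + 1)
      rw [← Nat.cast_inj (R := ℝ)] at this
      push_cast at this
      linarith
    simp only [G, Finset.sum_add_distrib, Finset.sum_sub_distrib, ← Finset.mul_sum, hid,
      Finset.sum_const, Finset.card_univ, Fintype.card_fin, nsmul_eq_mul]
    push_cast
    ring
  have hy (k) : |y k| ≤ (m + 1) * ρ := by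
    have hG := abs_sub_le_of_sum_eq (δ := ρ * (m / 2)) (fun k => by linarith [hlt k]) hGsum k
    simp only [Fintype.card_fin] at hG
    push_cast at hG
    rw [abs_mul, abs_neg, abs_of_pos (by positivity), inv_mul_le_iff₀ (by positivity)]
    refine hG.trans ?_
    refine mul_le_mul_of_nonneg_left ?_ (by positivity)
    nlinarith
  have hxi (j) : ‖φ j‖ ≤ (m + 1) * xi Φ :=
    (norm_le_mul_ceilMax (Φ.sum_apply_eq_zero (hφ j))).trans
      (by gcongr; exact ceilMax_le_xi Φ (hφ j))
  have hnorm : ‖∑ k, y k • φ (σ k)‖ ≤ (m + 1) ^ 3 * ρ * xi Φ := by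
    calc ‖∑ k, y k • φ (σ k)‖ ≤ ∑ _k : Fin (m + 1), ((m + 1) * ρ) * ((m + 1) * xi Φ) := by
          refine norm_sum_le_of_le _ fun k _ => ?_
          rw [norm_smul, Real.norm_eq_abs]
          exact mul_le_mul (hy k) (hxi _) (norm_nonneg _) (by positivity)
      _ = (m + 1) ^ 3 * ρ * xi Φ := by
          simp only [Finset.sum_const, Finset.card_univ, Fintype.card_fin, nsmul_eq_mul]
          push_cast
          ring
  have hdecomp : ∑ j, f j • φ (σ j) = orderedPoint φ σ + ∑ k, y k • φ (σ k) := by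
    have hf (k) : f k = ((m : ℝ) + 1)⁻¹ * k + y k + ((m : ℝ) + 1)⁻¹ * (∑ j, f j - m / 2) := by
      simp only [y, G]
      field_simp
      ring
    calc ∑ j, f j • φ (σ j) = ∑ k : Fin (m + 1), (((m : ℝ) + 1)⁻¹ * k + y k +
          ((m : ℝ) + 1)⁻¹ * (∑ j, f j - m / 2)) • φ (σ k) :=
          Finset.sum_congr rfl fun k _ => by rw [← hf k]
      _ = _ := by
          simp only [add_smul, Finset.sum_add_distrib, ← Finset.smul_sum, hsumσ, smul_zero,
            add_zero, orderedPoint, mul_smul]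
  obtain ⟨τ, ⟨hτ, hστ⟩, -⟩ := hS' σ
  have hmem := orderedPoint_sub_mem_of_zpowers hsum hστ
  refine ⟨_, ⟨_, ⟨τ, hτ, rfl⟩, ∑ k, y k • φ (σ k), ⟨mem_V0sub.1 ?_, hnorm⟩, rfl⟩,
    ∑ j, (⌊a j⌋ : ℝ) • φ j - (orderedPoint φ τ - orderedPoint φ σ), sub_mem hfloor hmem, ?_⟩
  · exact sum_mem fun k _ => Submodule.smul_mem _ _
      (mem_V0sub.2 (Φ.sum_apply_eq_zero (hφ _)))
  · rw [hfract, hdecomp]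
    dsimp only
    abel
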